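/- The Kochen-Specker qubit model reproduces the Born rule: for unit vectors ψ, φ on the Bloch sphere S², ∫_{S²} Θ(φ·λ) · (1/π) Θ(ψ·λ) (ψ·λ) dλ = |⟨φ|ψ⟩|² = (1 + φ·ψ)/2, where Θ is the Heaviside step function and dλ is the surface measure on S². -/

import Mathlib

open MeasureTheory Metric
open scoped RealInnerProductSpace

/-- The Heaviside step function: `Θ x = 1` for `x > 0` and `0` for `x ≤ 0`. -/
noncomputable def heaviside (x : ℝ) : ℝ := if 0 < x then 1 else 0

open Set Module Measure in
/-- Integration in polar coordinates of a product of an angular and a radial function. -/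
theorem integral_angular_mul_radial {E : Type*} [NormedAddCommGroup E] [NormedSpace ℝ E]
    [MeasurableSpace E] [Nontrivial E] (μ : Measure E) [FiniteDimensional ℝ E] [BorelSpace E]
    [μ.IsAddHaarMeasure] (f : E → ℝ) (g : ℝ → ℝ) :
    ∫ x, f (‖x‖⁻¹ • x) * g ‖x‖ ∂μ =
      (∫ l : sphere (0 : E) 1, f l ∂μ.toSphere) *
        ∫ r in Ioi (0 : ℝ), r ^ (finrank ℝ E - 1) * g r :=
  calc
    ∫ x, f (‖x‖⁻¹ • x) * g ‖x‖ ∂μ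
        = ∫ x : ({(0)}ᶜ : Set E), f (‖x.1‖⁻¹ • x.1) * g ‖x.1‖ ∂(μ.comap (↑)) := by
      rw [integral_subtype_comap (measurableSet_singleton _).compl
        fun x ↦ f (‖x‖⁻¹ • x) * g ‖x‖, restrict_compl_singleton]
    _ = ∫ x, f x.1 * g x.2 ∂μ.toSphere.prod (.volumeIoiPow (finrank ℝ E - 1)) := by
      simpa using μ.measurePreserving_homeomorphUnitSphereProd.integral_comp
        (Homeomorph.measurableEmbedding _)
        (fun p : sphere (0 : E) 1 × Ioi (0 : ℝ) ↦ f p.1 * g p.2)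
    _ = (∫ l : sphere (0 : E) 1, f l ∂μ.toSphere) *
          ∫ r : Ioi (0 : ℝ), g r ∂.volumeIoiPow (finrank ℝ E - 1) :=
      integral_prod_mul (fun l : sphere (0 : E) 1 ↦ f l) (fun r : Ioi (0 : ℝ) ↦ g r)
    _ = _ := by
      congr 1
      simp only [Measure.volumeIoiPow, ENNReal.ofReal]
      rw [integral_withDensity_eq_integral_smul,
        integral_subtype_comap measurableSet_Ioi
          fun a ↦ Real.toNNReal (a ^ (finrank ℝ E - 1)) • g a,
        setIntegral_congr_fun measurableSet_Ioi fun x hx ↦ ?_]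
      · rw [NNReal.smul_def, Real.coe_toNNReal _ (pow_nonneg hx.out.le _), smul_eq_mul]
      · exact (measurable_subtype_coe.pow_const _).real_toNNReal

/-- The Gaussian moments on the half line. -/
theorem integral_Ioi_pow_mul_exp_neg_sq (n : ℕ) :
    ∫ r in Set.Ioi (0 : ℝ), r ^ n * Real.exp (-r ^ 2) = 1 / 2 * Real.Gamma ((n + 1) / 2) := by
  have h := integral_rpow_mul_exp_neg_rpow (p := 2) (q := n) two_pos
    (by linarith [n.cast_nonneg (α := ℝ)])
  simpa using h

section InnerProductSpace

variable {E : Type*} [NormedAddCommGroup E] [InnerProductSpace ℝ E] [MeasurableSpace E]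
  [BorelSpace E] [FiniteDimensional ℝ E]

/-- The surface measure of the unit sphere is invariant under linear isometries. -/
theorem integral_toSphere_comp_linearIsometryEquiv [Nontrivial E] (f : E → ℝ) (e : E ≃ₗᵢ[ℝ] E) :
    ∫ l : sphere (0 : E) 1, f (e l) ∂(volume : Measure E).toSphere =
      ∫ l : sphere (0 : E) 1, f l ∂(volume : Measure E).toSphere := by
  set g : ℝ → ℝ := fun r ↦ Real.exp (-r ^ 2)
  have hg : ∫ r in Set.Ioi (0 : ℝ), r ^ (Module.finrank ℝ E - 1) * g r ≠ 0 := by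
    rw [integral_Ioi_pow_mul_exp_neg_sq]
    have := Real.Gamma_pos_of_pos
      (s := (((Module.finrank ℝ E - 1 : ℕ) : ℝ) + 1) / 2) (by positivity)
    positivity
  refine mul_right_cancel₀ hg ?_
  rw [← integral_angular_mul_radial volume (fun x ↦ f (e x)) g,
    ← integral_angular_mul_radial volume f g,
    ← e.measurePreserving.integral_comp e.toHomeomorph.measurableEmbedding
      (fun x ↦ f (‖x‖⁻¹ • x) * g ‖x‖)]
  simp

theorem ae_toSphere_inner_ne_zero {v : E} (hv : v ≠ 0) :
    ∀ᵐ l : sphere (0 : E) 1 ∂(volume : Measure E).toSphere, ⟪v, (l : E)⟫ ≠ 0 := by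
  have hmeas : MeasurableSet {l : sphere (0 : E) 1 | ⟪v, (l : E)⟫ = 0} :=
    measurableSet_eq_fun (by fun_prop) (by fun_prop)
  have hker : (volume : Measure E) ((ℝ ∙ v)ᗮ : Submodule ℝ E) = 0 := by
    refine Measure.addHaar_submodule _ _ fun h ↦ hv ?_
    have : v ∈ (ℝ ∙ v)ᗮ := h ▸ Submodule.mem_top
    rwa [Submodule.mem_orthogonal_singleton_iff_inner_right, inner_self_eq_zero] at this
  simp only [ae_iff, not_not]
  rw [Measure.toSphere_apply' _ hmeas, measure_mono_null _ hker, mul_zero]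
  rintro _ ⟨r, -, _, ⟨l, hl, rfl⟩, rfl⟩
  simp only [Set.mem_ofPred_eq] at hl
  simp [Submodule.mem_orthogonal_singleton_iff_inner_right, inner_smul_right, hl]

end InnerProductSpace

theorem integral_abs_mul_exp_neg_sq : ∫ x : ℝ, |x| * Real.exp (-x ^ 2) = 1 := by
  have h := integral_comp_abs (f := fun x ↦ x * Real.exp (-x ^ 2))
  have h' := integral_Ioi_pow_mul_exp_neg_sq 1
  norm_num at h h'
  rw [h, h']
  norm_num

theorem integral_abs_coord_mul_gaussian :
    ∫ x : EuclideanSpace ℝ (Fin 3), |x 0| * Real.exp (-‖x‖ ^ 2) = Real.pi := by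
  have hgauss : ∫ x : ℝ, Real.exp (-x ^ 2) = √Real.pi := by
    simpa using integral_gaussian 1
  calc
    _ = ∫ x : Fin 3 → ℝ, |x 0| * Real.exp (-(x 0 ^ 2 + x 1 ^ 2 + x 2 ^ 2)) := by
      rw [← (EuclideanSpace.volume_preserving_symm_measurableEquiv_toLp (Fin 3)).integral_comp
        (MeasurableEquiv.measurableEmbedding _)]
      simp [EuclideanSpace.norm_sq_eq, Fin.sum_univ_three]
    _ = ∫ x : Fin 3 → ℝ, ∏ i, (![fun t ↦ |t| * Real.exp (-t ^ 2), fun t ↦ Real.exp (-t ^ 2),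
          fun t ↦ Real.exp (-t ^ 2)] : Fin 3 → ℝ → ℝ) i (x i) := by
      congr with x
      simp only [Fin.prod_univ_three, neg_add, Real.exp_add]
      simp [mul_assoc]
    _ = Real.pi := by
      rw [integral_fintype_prod_volume_eq_prod]
      simp [Fin.prod_univ_three, integral_abs_mul_exp_neg_sq, hgauss, Real.pi_pos.le]

local notation "E3" => EuclideanSpace ℝ (Fin 3)
local notation "surf" => Measure.toSphere (volume : Measure (EuclideanSpace ℝ (Fin 3)))

theorem integral_toSphere_abs_inner (v : sphere (0 : E3) 1) :
    ∫ l : sphere (0 : E3) 1, |⟪(v : E3), (l : E3)⟫| ∂surf = 2 * Real.pi := by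
  have hcoord : ∫ l : sphere (0 : E3) 1, |(l : E3) 0| ∂surf = 2 * Real.pi := by
    have h := integral_angular_mul_radial (volume : Measure E3) (fun x ↦ |x 0|)
      (fun r ↦ r * Real.exp (-r ^ 2))
    have hr : ∫ r in Set.Ioi (0 : ℝ),
        r ^ (Module.finrank ℝ E3 - 1) * (r * Real.exp (-r ^ 2)) = 1 / 2 := by
      have := integral_Ioi_pow_mul_exp_neg_sq 3
      norm_num at this
      simp only [finrank_euclideanSpace_fin, ← mul_assoc, Nat.add_one_sub_one, ← pow_succ]
      simpa using this
    have hl : ∫ x : E3, |(‖x‖⁻¹ • x) 0| * (‖x‖ * Real.exp (-‖x‖ ^ 2)) = Real.pi := by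
      rw [← integral_abs_coord_mul_gaussian]
      congr with x
      rcases eq_or_ne x 0 with rfl | hx
      · simp
      · have := norm_ne_zero_iff.2 hx
        simp only [PiLp.smul_apply, smul_eq_mul, abs_mul, abs_inv, abs_norm]
        field_simp
    rw [hl, hr] at h
    linarith
  set e := (EuclideanSpace.single 0 1 : E3)
  set R := (ℝ ∙ ((v : E3) - e))ᗮ.reflection
  have hR : R v = e := Submodule.reflection_sub (by simp [e])
  rw [← hcoord, ← integral_toSphere_comp_linearIsometryEquiv (fun x : E3 ↦ |x 0|) R]
  congr with l
  rw [← R.inner_map_map, hR]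
  simp [e, EuclideanSpace.inner_single_left]

theorem measurable_heaviside : Measurable heaviside :=
  Measurable.ite measurableSet_Ioi measurable_const measurable_const

theorem abs_heaviside_le_one (x : ℝ) : |heaviside x| ≤ 1 := by
  unfold heaviside
  split_ifs <;> simp

theorem heaviside_mul_self (x : ℝ) : heaviside x * x = (|x| + x) / 2 := by
  unfold heaviside
  split_ifs with h
  · rw [abs_of_pos h]; ring
  · rw [abs_of_nonpos (not_lt.1 h)]; ring

theorem heaviside_add_heaviside_neg {x : ℝ} (hx : x ≠ 0) : heaviside x + heaviside (-x) = 1 := by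
  unfold heaviside
  rcases hx.lt_or_gt with h | h <;> simp [h, h.not_gt]

theorem integrable_toSphere_inner (v : E3) :
    Integrable (fun l : sphere (0 : E3) 1 ↦ ⟪v, (l : E3)⟫) surf :=
  Integrable.of_bound (by fun_prop) ‖v‖ (.of_forall fun l ↦ by
    simpa using norm_inner_le_norm (𝕜 := ℝ) v (l : E3))

theorem MeasureTheory.Integrable.heaviside_inner_mul {f : sphere (0 : E3) 1 → ℝ}
    (hf : Integrable f surf) (v : E3) :
    Integrable (fun l : sphere (0 : E3) 1 ↦ heaviside ⟪v, (l : E3)⟫ * f l) surf :=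
  hf.bdd_mul (c := 1) (measurable_heaviside.comp (by fun_prop)).aestronglyMeasurable
    (.of_forall fun _ ↦ abs_heaviside_le_one _)

theorem integral_toSphere_inner (v : E3) :
    ∫ l : sphere (0 : E3) 1, ⟪v, (l : E3)⟫ ∂surf = 0 := by
  have h := integral_toSphere_comp_linearIsometryEquiv (fun x : E3 ↦ ⟪v, x⟫) (.neg ℝ)
  simp only [LinearIsometryEquiv.coe_neg, inner_neg_right, integral_neg] at h
  linarith

theorem integral_toSphere_heaviside_mul_abs_inner (φ ψ : sphere (0 : E3) 1) :
    ∫ l : sphere (0 : E3) 1, heaviside ⟪(φ : E3), (l : E3)⟫ * |⟪(ψ : E3), (l : E3)⟫| ∂surf =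
      Real.pi := by
  have hint := (integrable_toSphere_inner (ψ : E3)).abs
  have h := integral_toSphere_comp_linearIsometryEquiv
    (fun x : E3 ↦ heaviside ⟪(φ : E3), x⟫ * |⟪(ψ : E3), x⟫|) (.neg ℝ)
  simp only [LinearIsometryEquiv.coe_neg, inner_neg_right, abs_neg] at h
  have hneg := hint.heaviside_inner_mul (-(φ : E3))
  simp only [inner_neg_left] at hneg
  have hsum := integral_add (hint.heaviside_inner_mul (φ : E3)) hneg
  have hcongr : ∫ l : sphere (0 : E3) 1, (heaviside ⟪(φ : E3), (l : E3)⟫ * |⟪(ψ : E3), (l : E3)⟫| +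
      heaviside (-⟪(φ : E3), (l : E3)⟫) * |⟪(ψ : E3), (l : E3)⟫|) ∂surf = 2 * Real.pi := by
    rw [← integral_toSphere_abs_inner ψ]
    refine integral_congr_ae ?_
    filter_upwards [ae_toSphere_inner_ne_zero (ne_zero_of_mem_unit_sphere φ)] with l hl
    rw [← add_mul, heaviside_add_heaviside_neg hl, one_mul]
  linarith

theorem integral_toSphere_heaviside_mul_inner_of_orthogonal {v w : E3} (h : ⟪w, v⟫ = 0) :
    ∫ l : sphere (0 : E3) 1, heaviside ⟪v, (l : E3)⟫ * ⟪w, (l : E3)⟫ ∂surf = 0 := by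
  set R := (ℝ ∙ w)ᗮ.reflection
  have hv : R v = v := Submodule.reflection_mem_subspace_eq_self
    (Submodule.mem_orthogonal_singleton_iff_inner_right.2 h)
  have hw : R w = -w := Submodule.reflection_orthogonalComplement_singleton_eq_neg w
  have hvR (x : E3) : ⟪v, R x⟫ = ⟪v, x⟫ := by rw [← R.inner_map_map v x, hv]
  have hwR (x : E3) : ⟪w, R x⟫ = -⟪w, x⟫ := by
    rw [← R.inner_map_map w x, hw, inner_neg_left, neg_neg]
  have hinv := integral_toSphere_comp_linearIsometryEquiv
    (fun x : E3 ↦ heaviside ⟪v, x⟫ * ⟪w, x⟫) R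
  simp only [hvR, hwR, mul_neg, integral_neg] at hinv
  linarith

theorem integral_toSphere_heaviside_mul_inner (φ : sphere (0 : E3) 1) (v : E3) :
    ∫ l : sphere (0 : E3) 1, heaviside ⟪(φ : E3), (l : E3)⟫ * ⟪v, (l : E3)⟫ ∂surf =
      Real.pi * ⟪(φ : E3), v⟫ := by
  set c := ⟪(φ : E3), v⟫
  set w := v - c • (φ : E3)
  have hw : ⟪w, (φ : E3)⟫ = 0 := by
    simp [w, c, inner_sub_left, inner_smul_left, real_inner_comm]
  have hself : ∫ l : sphere (0 : E3) 1,
      heaviside ⟪(φ : E3), (l : E3)⟫ * ⟪(φ : E3), (l : E3)⟫ ∂surf = Real.pi := by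
    simp only [heaviside_mul_self]
    rw [integral_div, integral_add (integrable_toSphere_inner _).abs (integrable_toSphere_inner _),
      integral_toSphere_abs_inner, integral_toSphere_inner]
    ring
  calc
    _ = ∫ l : sphere (0 : E3) 1,
        (c * (heaviside ⟪(φ : E3), (l : E3)⟫ * ⟪(φ : E3), (l : E3)⟫) +
          heaviside ⟪(φ : E3), (l : E3)⟫ * ⟪w, (l : E3)⟫) ∂surf := by
      congr with l
      simp only [w, inner_sub_left, real_inner_smul_left]
      ring
    _ = Real.pi * c := by
      rw [integral_add (((integrable_toSphere_inner _).heaviside_inner_mul _).const_mul c)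
        ((integrable_toSphere_inner _).heaviside_inner_mul _), integral_const_mul, hself,
        integral_toSphere_heaviside_mul_inner_of_orthogonal hw]
      ring

/-- The Kochen-Specker qubit model reproduces the Born rule: for unit vectors
`ψ, φ` on the Bloch sphere `S²` (with its surface measure `σ`),
`∫_{S²} Θ(φ·λ) (1/π) Θ(ψ·λ) (ψ·λ) dλ = (1 + φ·ψ)/2 = |⟨φ|ψ⟩|²`. -/
theorem kochenSpecker_born_rule
    (ψ φ : sphere (0 : EuclideanSpace ℝ (Fin 3)) 1) :
    ∫ l : sphere (0 : EuclideanSpace ℝ (Fin 3)) 1,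
        heaviside ⟪(φ : EuclideanSpace ℝ (Fin 3)), (l : EuclideanSpace ℝ (Fin 3))⟫ *
        ((1 / Real.pi) * heaviside ⟪(ψ : EuclideanSpace ℝ (Fin 3)), (l : EuclideanSpace ℝ (Fin 3))⟫ *
          ⟪(ψ : EuclideanSpace ℝ (Fin 3)), (l : EuclideanSpace ℝ (Fin 3))⟫)
        ∂((volume : Measure (EuclideanSpace ℝ (Fin 3))).toSphere)
      = (1 + ⟪(φ : EuclideanSpace ℝ (Fin 3)), (ψ : EuclideanSpace ℝ (Fin 3))⟫) / 2 := by
  calc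
    _ = ∫ l : sphere (0 : E3) 1, 1 / (2 * Real.pi) *
        (heaviside ⟪(φ : E3), (l : E3)⟫ * |⟪(ψ : E3), (l : E3)⟫| +
          heaviside ⟪(φ : E3), (l : E3)⟫ * ⟪(ψ : E3), (l : E3)⟫) ∂surf := by
      congr with l
      rw [mul_assoc (1 / Real.pi), heaviside_mul_self]
      field_simp
    _ = (1 + ⟪(φ : E3), (ψ : E3)⟫) / 2 := by
      rw [integral_const_mul, integral_add
        ((integrable_toSphere_inner _).abs.heaviside_inner_mul _)
        ((integrable_toSphere_inner _).heaviside_inner_mul _),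
        integral_toSphere_heaviside_mul_abs_inner, integral_toSphere_heaviside_mul_inner]
      field_simp
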